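/- Let φ: S → R be a ring morphism, W ∈ S, and (X,d) a finite rank matrix factorisation of φ(W) over R with fixed homogeneous basis. Let t = (t₁,…,tₙ) be a quasi-regular sequence in R such that each tⱼ·1_X is null-homotopic over R, and suppose given a deformation retract datum of ℤ-graded complexes over S: σ: (R/tR,0) → (K(t),δ), π: (K(t),δ) → (R/tR,0) the R-linear augmentation, and an S-linear degree −1 homotopy h on K(t), with πσ = 1, σπ = 1 + δh + hδ, h² = 0, hσ = 0, πh = 0. Then the augmentation π: X⊗_R K(t) → X/tX is a homotopy equivalence of linear factorisations of W over S, and (X/tX, X⊗K(t), σ_∞, π, h_∞) with σ_∞ = Σ_{m≥0}(hd)^m σ and h_∞ = Σ_{m≥0}(hd)^m h (h, σ extended over the basis of X with Koszul signs) is a deformation retract datum of linear factorisations of W over S. -/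

import Mathlib

/-!
STATEMENT 3.

Conventions.  A finite rank matrix factorisation `X` of `φ(W)` over `R` with a fixed
homogeneous basis is encoded as `ι → R` with a parity function `par : ι → Bool`; the
grading involution is `gX par`, odd maps anticommute with it and `d² = φ(W)·1`.  The
Koszul complex `K(t)` on `t = u : Fin n → R` is modelled as `Finset (Fin n) → R`
(component `R·dt_I` at `I`, of exterior degree `-|I|`), with the contraction
differential `δ`; the augmentation `π : K(t) → R/tR` is projection to the degree-zero
component followed by the quotient map.  `σ` (degree `0`) and `h` (degree `-1`) are only
`S`-linear; degrees are expressed through supports.  Tensoring with `X` over `R`: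
`X ⊗ K(t) ≅ ι → K(t)` and `X/tX = X ⊗ R/tR ≅ ι → R/tR`; `d ⊗ 1` is the matrix
extension of `d`, maps of the second factor are extended over the basis with the Koszul
sign `(-1)^{|ξᵢ|}` when odd.  Quasi-regularity is the classical coefficient condition.
The sums `σ_∞ = Σ_{m≥0} (hd)^m σ` and `h_∞ = Σ_{m≥0} (hd)^m h` are finite: all terms
with `m > n` vanish for degree reasons, so they are written as sums over `m ≤ n`.
-/

namespace Stmt3

open Finset

/-- Quasi-regularity of a sequence (EGA 0.15.1 / Matsumura §16). -/
def IsQuasiRegular {R : Type*} [CommRing R] {n : ℕ} (u : Fin n → R) : Prop :=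
  ∀ (k : ℕ) (F : MvPolynomial (Fin n) R), F.IsHomogeneous k →
    MvPolynomial.eval u F ∈ (Ideal.span (Set.range u)) ^ (k + 1) →
    ∀ m, MvPolynomial.coeff m F ∈ Ideal.span (Set.range u)

/-- The Koszul complex `K(t)`, with component `R·dt_I` at `I`. -/
abbrev KT (R : Type*) (n : ℕ) := Finset (Fin n) → R

def ksign (R : Type*) [CommRing R] {n : ℕ} (i : Fin n) (I : Finset (Fin n)) : R :=
  (-1 : R) ^ (I.filter (fun j => j < i)).card

/-- The Koszul differential (contraction with `Σᵢ tᵢ(dtᵢ)*`). -/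
def delK {R : Type*} [CommRing R] {n : ℕ} (u : Fin n → R) : Module.End R (KT R n) :=
  LinearMap.pi fun J =>
    ∑ i : Fin n,
      if i ∈ J then 0
      else (ksign R i J * u i) • LinearMap.proj (insert i J)

/-- The grading involution of the ℤ/2-folded Koszul complex. -/
def gK (R : Type*) [CommRing R] (n : ℕ) : Module.End R (KT R n) :=
  LinearMap.pi fun I => ((-1 : R) ^ I.card) • LinearMap.proj I

def gX (R : Type*) [CommRing R] {ι : Type*} [Fintype ι] [DecidableEq ι]
    (par : ι → Bool) : Module.End R (ι → R) :=
  LinearMap.pi fun i => (if par i then (-1 : R) else 1) • LinearMap.proj i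

def dmat {R : Type*} [CommRing R] {ι : Type*} [Fintype ι] [DecidableEq ι]
    (d : Module.End R (ι → R)) (a b : ι) : R :=
  d (Pi.single b 1) a

/-- `d ⊗ 1` (extension of a matrix over `R`; no Koszul sign). -/
def matExt {R M : Type*} [CommRing R] [AddCommGroup M] [Module R M]
    {ι : Type*} [Fintype ι] [DecidableEq ι] (A : ι → ι → R) :
    (ι → M) →ₗ[R] (ι → M) :=
  LinearMap.pi fun a => ∑ b, A a b • LinearMap.proj b

/-- `1 ⊗ t` for even `t` (no sign). -/
def evExt (S : Type*) [CommRing S] {L M : Type*} [AddCommGroup L] [Module S L]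
    [AddCommGroup M] [Module S M] {ι : Type*} (t : L →ₗ[S] M) :
    (ι → L) →ₗ[S] (ι → M) :=
  LinearMap.pi fun i => t ∘ₗ LinearMap.proj i

/-- `1 ⊗ t` with the Koszul sign `(-1)^{|ξᵢ|}` (for odd `t`, and for gradings). -/
def oddExt (S : Type*) [CommRing S] {L M : Type*} [AddCommGroup L] [Module S L]
    [AddCommGroup M] [Module S M] {ι : Type*} (par : ι → Bool) (t : L →ₗ[S] M) :
    (ι → L) →ₗ[S] (ι → M) :=
  LinearMap.pi fun i =>
    (if par i then (-1 : ℤ) else 1) • (t ∘ₗ LinearMap.proj i)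

end Stmt3

namespace Stmt3

section Ring

variable {A : Type*} [Ring A]

/-- The algebraic core of the perturbation lemma: the defect of `1 - hd` being a chain map. -/
lemma one_sub_mul_add {d δ h p w : A} (hp : p = 1 + (δ * h + h * δ))
    (hanti : d * δ + δ * d = 0) (hw : h * (d * d) = w * h) :
    (1 - h * d) * (d + δ) = δ * (1 - h * d) - w * h + p * d := by
  have hdδ : d * δ = -(δ * d) := eq_neg_of_add_eq_zero_left hanti
  have h1 : (1 - h * d) * (d + δ) = d + δ - h * (d * d) - h * (d * δ) := by noncomm_ring
  rw [h1, hw, hdδ, hp]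
  noncomm_ring

/-- The perturbed differential on the perturbed inclusion `T`, the inverse of `1 - hd`. -/
lemma perturbed_differential {d δ h p w T : A} (hp : p = 1 + (δ * h + h * δ))
    (hanti : d * δ + δ * d = 0) (hw : h * (d * d) = w * h)
    (hh : h * h = 0) (hph : p * h = 0) (hpd : p * d * p = p * d)
    (hT : (1 - h * d) * T = 1) (hT' : T * (1 - h * d) = 1) :
    (d + δ) * T = T * δ - T * w * h + T * (p * d) := by
  have absorb : ∀ y : A, y * h = 0 → y * T = y := fun y hy => by
    have h1 : y * (1 - h * d) = y := by
      rw [mul_sub, mul_one, ← mul_assoc, hy, zero_mul, sub_zero]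
    rw [← h1, mul_assoc, hT, mul_one, h1]
  have h2 : (1 - h * d) * ((d + δ) * T) = δ - w * h + p * d := by
    rw [← mul_assoc, one_sub_mul_add hp hanti hw, add_mul, sub_mul, mul_assoc δ, hT,
      mul_assoc w, absorb h hh, ← hpd, mul_assoc _ p T, absorb p hph, mul_one]
  calc (d + δ) * T = T * ((1 - h * d) * ((d + δ) * T)) := by rw [← mul_assoc, hT', one_mul]
    _ = _ := by rw [h2]; noncomm_ring

/-- Perturbing the homotopy of a deformation retract. -/
lemma perturbed_homotopy {d δ h p w T : A} (hp : p = 1 + (δ * h + h * δ))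
    (hanti : d * δ + δ * d = 0) (hw : h * (d * d) = w * h)
    (hh : h * h = 0) (hph : p * h = 0) (hpd : p * d * p = p * d)
    (hT : (1 - h * d) * T = 1) (hT' : T * (1 - h * d) = 1) :
    T * p = 1 + ((d + δ) * (T * h) + T * h * (d + δ)) := by
  have h1 : (d + δ) * (T * h) = T * δ * h := by
    rw [← mul_assoc, perturbed_differential hp hanti hw hh hph hpd hT hT', add_mul, sub_mul,
      mul_assoc _ h h, hh, mul_assoc T (p * d) h, ← hpd, mul_assoc (p * d) p h, hph]
    simp
  rw [h1, ← hT', hp]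
  noncomm_ring

end Ring

section Koszul

variable {R : Type*} [CommRing R] {n : ℕ}

lemma delK_apply (u : Fin n → R) (f : KT R n) (J : Finset (Fin n)) :
    delK u f J = ∑ i, if i ∈ J then 0 else ksign R i J * u i * f (insert i J) := by
  simp only [delK, LinearMap.pi_apply, LinearMap.sum_apply]
  refine Finset.sum_congr rfl fun i _ => ?_
  split_ifs <;> simp

@[simp] lemma gK_apply (f : KT R n) (J : Finset (Fin n)) :
    gK R n f J = (-1) ^ J.card * f J := by
  simp [gK]

lemma ksign_insert_of_lt {i j : Fin n} {J : Finset (Fin n)} (hi : i ∉ J) (hij : i < j) :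
    ksign R j (insert i J) = -ksign R j J := by
  rw [ksign, Finset.filter_insert, if_pos hij,
    Finset.card_insert_of_notMem (by simp [hi]), pow_succ, ksign]
  ring

lemma ksign_insert_of_not_lt {i j : Fin n} {J : Finset (Fin n)} (hij : ¬ i < j) :
    ksign R j (insert i J) = ksign R j J := by
  rw [ksign, Finset.filter_insert, if_neg hij, ksign]

lemma ksign_swap {i j : Fin n} {J : Finset (Fin n)} (hi : i ∉ J) (hj : j ∉ J) (hij : i ≠ j) :
    ksign R i J * ksign R j (insert i J) = -(ksign R j J * ksign R i (insert j J)) := by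
  rcases lt_or_gt_of_ne hij with hlt | hlt
  · rw [ksign_insert_of_lt hi hlt, ksign_insert_of_not_lt (not_lt.2 hlt.le)]
    ring
  · rw [ksign_insert_of_lt hj hlt, ksign_insert_of_not_lt (not_lt.2 hlt.le)]
    ring

lemma delK_delK (u : Fin n → R) (f : KT R n) : delK u (delK u f) = 0 := by
  funext J
  have hexp : delK u (delK u f) J = ∑ x : Fin n × Fin n,
      if x.1 ∈ J ∨ x.2 ∈ J ∨ x.1 = x.2 then 0 else
        ksign R x.1 J * ksign R x.2 (insert x.1 J) *
          (u x.1 * u x.2 * f (insert x.2 (insert x.1 J))) := by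
    rw [delK_apply, Fintype.sum_prod_type]
    refine Finset.sum_congr rfl fun i _ => ?_
    by_cases hi : i ∈ J
    · simp [hi]
    · rw [if_neg hi, delK_apply, Finset.mul_sum]
      refine Finset.sum_congr rfl fun j _ => ?_
      by_cases hj : j ∈ J
      · simp [hj]
      · by_cases hij : i = j
        · simp [hij]
        · have hji : j ∉ insert i J := by simp [hj, Ne.symm hij]
          simp only [hi, hj, hij, hji, or_self, if_false]
          ring
  rw [hexp]
  refine Finset.sum_involution (fun x _ => x.swap) ?_ ?_ (fun _ _ => Finset.mem_univ _)
    (fun _ _ => Prod.swap_swap _)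
  · rintro ⟨i, j⟩ -
    by_cases hi : i ∈ J
    · simp [hi]
    by_cases hj : j ∈ J
    · simp [hj]
    by_cases hij : i = j
    · simp [hij]
    simp only [Prod.swap, hi, hj, hij, Ne.symm hij, or_self, if_false]
    rw [ksign_swap hi hj hij, Finset.insert_comm j i J]
    ring
  · rintro ⟨i, j⟩ - hne heq
    simp only [Prod.swap, Prod.mk.injEq] at heq
    simp [heq.1] at hne

lemma delK_gK (u : Fin n → R) (f : KT R n) : delK u (gK R n f) = -gK R n (delK u f) := by
  funext J
  rw [Pi.neg_apply, gK_apply, delK_apply, delK_apply, Finset.mul_sum, ← Finset.sum_neg_distrib]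
  refine Finset.sum_congr rfl fun i _ => ?_
  by_cases hi : i ∈ J
  · simp [hi]
  · rw [if_neg hi, if_neg hi, gK_apply, Finset.card_insert_of_notMem hi, pow_succ]
    ring

lemma delK_eq_zero (u : Fin n → R) {f : KT R n} (hf : ∀ I, I ≠ ∅ → f I = 0) :
    delK u f = 0 := by
  funext J
  rw [delK_apply]
  refine Finset.sum_eq_zero fun i _ => ?_
  rw [hf _ (Finset.insert_ne_empty i J)]
  simp

lemma delK_apply_empty_mem (u : Fin n → R) (f : KT R n) :
    delK u f ∅ ∈ Ideal.span (Set.range u) := by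
  rw [delK_apply]
  refine Ideal.sum_mem _ fun i _ => ?_
  rw [if_neg (Finset.notMem_empty i)]
  exact Ideal.mul_mem_right _ _ (Ideal.mul_mem_left _ _ (Ideal.subset_span ⟨i, rfl⟩))

variable {S : Type*} [CommRing S] [Algebra S R]

lemma degree_one_map_gK {h : KT R n →ₗ[S] KT R n}
    (hh : ∀ (k : ℕ) (f : KT R n), (∀ I, I.card ≠ k → f I = 0) →
      ∀ J, J.card ≠ k + 1 → h f J = 0) (f : KT R n) :
    h (gK R n f) = -gK R n (h f) := by
  suffices hext : h ∘ₗ (gK R n).restrictScalars S = -((gK R n).restrictScalars S ∘ₗ h) from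
    LinearMap.congr_fun hext f
  refine LinearMap.pi_ext fun I x => ?_
  have hsingle : ∀ I' : Finset (Fin n), I'.card ≠ I.card → (Pi.single I x : KT R n) I' = 0 :=
    fun I' hI' => Pi.single_eq_of_ne (fun e => hI' (by rw [e])) _
  have hg : gK R n (Pi.single I x) = ((-1 : S) ^ I.card) • (Pi.single I x : KT R n) := by
    funext J
    rw [gK_apply, Pi.smul_apply, Algebra.smul_def, map_pow, map_neg, map_one]
    by_cases hJ : J = I
    · rw [hJ]
    · rw [Pi.single_eq_of_ne hJ, mul_zero, mul_zero]
  funext J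
  simp only [LinearMap.comp_apply, LinearMap.restrictScalars_apply, LinearMap.neg_apply,
    Pi.neg_apply, gK_apply, hg]
  rw [map_smul, Pi.smul_apply, Algebra.smul_def, map_pow, map_neg, map_one]
  by_cases hJ : J.card = I.card + 1
  · rw [hJ, pow_succ]
    ring
  · rw [hh _ _ hsingle J hJ]
    simp

lemma degree_one_map_support {h : KT R n →ₗ[S] KT R n}
    (hh : ∀ (k : ℕ) (f : KT R n), (∀ I, I.card ≠ k → f I = 0) →
      ∀ J, J.card ≠ k + 1 → h f J = 0) {m : ℕ} {f : KT R n}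
    (hf : ∀ I, I.card < m → f I = 0) {J : Finset (Fin n)} (hJ : J.card < m + 1) :
    h f J = 0 := by
  have hsum : f = ∑ I, Pi.single I (f I) := (Finset.univ_sum_single f).symm
  rw [hsum, map_sum, Finset.sum_apply]
  refine Finset.sum_eq_zero fun I _ => ?_
  by_cases hI : I.card < m
  · rw [hf I hI]
    simp
  · exact hh I.card _ (fun I' hI' => Pi.single_eq_of_ne (fun e => hI' (by rw [e])) _) J (by omega)

end Koszul

section Extension

variable {R : Type*} [CommRing R] {ι : Type*}

/-- The sign `(-1)^{|ξᵢ|}`. -/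
def psign (par : ι → Bool) (i : ι) : ℤ := if par i then -1 else 1

lemma psign_mul_self (par : ι → Bool) (i : ι) : psign par i * psign par i = 1 := by
  unfold psign; split_ifs <;> rfl

lemma psign_smul_psign_smul {M : Type*} [AddCommGroup M] (par : ι → Bool) (i : ι) (x : M) :
    psign par i • psign par i • x = x := by
  rw [smul_smul, psign_mul_self, one_smul]

section

variable {S : Type*} [CommRing S] {L M : Type*} [AddCommGroup L] [Module S L] [AddCommGroup M]
  [Module S M]

lemma oddExt_apply (par : ι → Bool) (t : L →ₗ[S] M) (x : ι → L) (i : ι) :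
    oddExt S par t x i = psign par i • t (x i) := rfl

lemma evExt_apply (t : L →ₗ[S] M) (x : ι → L) (i : ι) : evExt S t x i = t (x i) := rfl

end

variable [Fintype ι] [DecidableEq ι]

lemma matExt_apply {M : Type*} [AddCommGroup M] [Module R M] (A : ι → ι → R) (x : ι → M)
    (a : ι) : matExt A x a = ∑ b, A a b • x b := by
  simp [matExt]

lemma dmat_mul_dmat {d : Module.End R (ι → R)} {w : R}
    (hd : d * d = w • (1 : Module.End R (ι → R))) (a b : ι) :
    ∑ c, dmat d a c * dmat d c b = if a = b then w else 0 := by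
  have h1 := congrFun (LinearMap.congr_fun hd (Pi.single b 1)) a
  have h2 : d (d (Pi.single b 1)) a = ∑ c, dmat d a c * dmat d c b := by
    conv_lhs => rw [← Finset.univ_sum_single (d (Pi.single b 1)), map_sum, Finset.sum_apply]
    refine Finset.sum_congr rfl fun c _ => ?_
    have h3 : (Pi.single c (d (Pi.single b 1) c) : ι → R)
        = d (Pi.single b 1) c • Pi.single c 1 := by
      rw [← Pi.single_smul, smul_eq_mul, mul_one]
    rw [h3, map_smul, Pi.smul_apply, smul_eq_mul, mul_comm]
    rfl
  rw [← h2]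
  refine h1.trans ?_
  simp [Pi.single_apply]

lemma matExt_dmat_sq {M : Type*} [AddCommGroup M] [Module R M] {d : Module.End R (ι → R)} {w : R}
    (hd : d * d = w • (1 : Module.End R (ι → R))) (x : ι → M) :
    matExt (dmat d) (matExt (dmat d) x) = w • x := by
  funext a
  simp only [matExt_apply, Finset.smul_sum, smul_smul]
  rw [Finset.sum_comm]
  simp only [← Finset.sum_smul, dmat_mul_dmat hd, ite_smul, zero_smul, Finset.sum_ite_eq,
    Finset.mem_univ, if_true, Pi.smul_apply]

lemma psign_smul_dmat {par : ι → Bool} {d : Module.End R (ι → R)}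
    (hd : d * gX R par = -(gX R par * d)) (a b : ι) :
    psign par b • dmat d a b = -(psign par a • dmat d a b) := by
  have h1 := congrFun (LinearMap.congr_fun hd (Pi.single b 1)) a
  have h2 : gX R par (Pi.single b 1) = psign par b • (Pi.single b 1 : ι → R) := by
    funext c
    by_cases hc : c = b
    · subst hc
      simp only [gX, psign, LinearMap.pi_apply, LinearMap.smul_apply, LinearMap.proj_apply,
        Pi.smul_apply]
      split_ifs <;> simp
    · simp only [gX, LinearMap.pi_apply, LinearMap.smul_apply, LinearMap.proj_apply,
        Pi.smul_apply, Pi.single_eq_of_ne hc, smul_zero]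
  have h3 : gX R par (d (Pi.single b 1)) a = psign par a • dmat d a b := by
    simp only [gX, psign, dmat, LinearMap.pi_apply, LinearMap.smul_apply, LinearMap.proj_apply]
    split_ifs <;> simp
  rw [Module.End.mul_apply, h2, map_zsmul, LinearMap.neg_apply, Module.End.mul_apply,
    Pi.neg_apply, h3] at h1
  exact h1

/-- An odd matrix anticommutes with the signed extension of any linear map. -/
lemma matExt_oddExt {L M : Type*} [AddCommGroup L] [Module R L] [AddCommGroup M] [Module R M]
    {par : ι → Bool} {d : Module.End R (ι → R)}
    (hd : d * gX R par = -(gX R par * d)) (t : L →ₗ[R] M) (x : ι → L) :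
    matExt (dmat d) (oddExt R par t x) = -oddExt R par t (matExt (dmat d) x) := by
  funext a
  simp only [matExt_apply, oddExt_apply, Pi.neg_apply, map_sum, map_smul, Finset.smul_sum,
    ← Finset.sum_neg_distrib]
  refine Finset.sum_congr rfl fun b _ => ?_
  rw [smul_comm, ← smul_assoc, psign_smul_dmat hd, neg_smul, smul_assoc]

lemma matExt_evExt {L M : Type*} [AddCommGroup L] [Module R L] [AddCommGroup M] [Module R M]
    (A : ι → ι → R) (t : L →ₗ[R] M) (x : ι → L) :
    matExt A (evExt R t x) = evExt R t (matExt A x) := by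
  funext a
  simp only [matExt_apply, evExt_apply, map_sum, map_smul]

lemma pow_oddExt_matExt_apply_eq_zero {S : Type*} [CommRing S] [Algebra S R] {n : ℕ}
    {h : KT R n →ₗ[S] KT R n}
    (hh : ∀ (k : ℕ) (f : KT R n), (∀ I, I.card ≠ k → f I = 0) →
      ∀ J, J.card ≠ k + 1 → h f J = 0) (par : ι → Bool) (A : ι → ι → R) (m : ℕ)
    (x : ι → KT R n) (a : ι) {J : Finset (Fin n)} (hJ : J.card < m) :
    ((oddExt S par h *
      ((matExt A : Module.End R (ι → KT R n)).restrictScalars S)) ^ m) x a J = 0 := by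
  induction m generalizing a J with
  | zero => omega
  | succ m ih =>
    rw [pow_succ', Module.End.mul_apply, Module.End.mul_apply, oddExt_apply, Pi.smul_apply,
      degree_one_map_support hh (m := m) _ hJ, smul_zero]
    intro I hI
    rw [LinearMap.restrictScalars_apply, matExt_apply, Finset.sum_apply]
    refine Finset.sum_eq_zero fun b _ => ?_
    rw [Pi.smul_apply, ih b hI, smul_zero]

lemma pow_oddExt_matExt_eq_zero {S : Type*} [CommRing S] [Algebra S R] {n : ℕ}
    {h : KT R n →ₗ[S] KT R n}
    (hh : ∀ (k : ℕ) (f : KT R n), (∀ I, I.card ≠ k → f I = 0) →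
      ∀ J, J.card ≠ k + 1 → h f J = 0) (par : ι → Bool) (A : ι → ι → R) :
    (oddExt S par h *
      ((matExt A : Module.End R (ι → KT R n)).restrictScalars S)) ^ (n + 1) = 0 := by
  refine LinearMap.ext fun x => funext fun a => funext fun J => ?_
  exact pow_oddExt_matExt_apply_eq_zero hh par A (n + 1) x a
    (Nat.lt_succ_of_le (by simpa using J.card_le_univ))

end Extension

end Stmt3

set_option maxHeartbeats 1000000 in
open Stmt3 in
theorem statement3
    {S R : Type*} [CommRing S] [CommRing R] [Algebra S R] (W : S) {n : ℕ}
    -- X: finite rank matrix factorisation of φ(W) over R with homogeneous basis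
    {ι : Type*} [Fintype ι] [DecidableEq ι] (par : ι → Bool)
    (d : Module.End R (ι → R))
    (hd_odd : d * gX R par = -(gX R par * d))
    (hd_sq : d * d = algebraMap S R W • (1 : Module.End R (ι → R)))
    -- t = u a quasi-regular sequence, each tⱼ·1_X null-homotopic over R
    (u : Fin n → R) (hqreg : IsQuasiRegular u)
    (hnull : ∀ j, ∃ lam : Module.End R (ι → R),
      lam * gX R par = -(gX R par * lam) ∧
      lam * d + d * lam = u j • (1 : Module.End R (ι → R)))
    -- a deformation retract datum of ℤ-graded complexes over S:
    (σ : (R ⧸ Ideal.span (Set.range u)) →ₗ[S] KT R n)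
    (h : KT R n →ₗ[S] KT R n)
    -- σ lands in exterior degree 0, h has degree -1
    (hσ_deg : ∀ x I, I ≠ (∅ : Finset (Fin n)) → σ x I = 0)
    (hh_deg : ∀ (kk : ℕ) (f : KT R n), (∀ I, I.card ≠ kk → f I = 0) →
      ∀ J, J.card ≠ kk + 1 → h f J = 0)
    -- π σ = 1 and σ π = 1 + δh + hδ,  where π = mkQ ∘ proj ∅ is the augmentation
    (hπσ : ((Submodule.mkQ (Ideal.span (Set.range u))) ∘ₗ
        (LinearMap.proj (∅ : Finset (Fin n)) : KT R n →ₗ[R] R)).restrictScalars S ∘ₗ σ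
      = LinearMap.id)
    (hσπ : σ ∘ₗ ((Submodule.mkQ (Ideal.span (Set.range u))) ∘ₗ
        (LinearMap.proj (∅ : Finset (Fin n)) : KT R n →ₗ[R] R)).restrictScalars S
      = LinearMap.id +
        ((delK u).restrictScalars S ∘ₗ h + h ∘ₗ (delK u).restrictScalars S))
    -- side conditions h² = 0, hσ = 0, πh = 0
    (hh2 : h ∘ₗ h = 0) (hhσ : h ∘ₗ σ = 0)
    (hπh : ((Submodule.mkQ (Ideal.span (Set.range u))) ∘ₗ
        (LinearMap.proj (∅ : Finset (Fin n)) : KT R n →ₗ[R] R)).restrictScalars S ∘ₗ h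
      = 0) :
    -- notations
    let Q := R ⧸ Ideal.span (Set.range u)
    let D : Module.End R (ι → KT R n) :=
      matExt (dmat d) + oddExt R par (delK u : KT R n →ₗ[R] KT R n)
    let G : Module.End R (ι → KT R n) :=
      oddExt R par (gK R n : KT R n →ₗ[R] KT R n)
    let DQ : Module.End R (ι → Q) := matExt (dmat d)
    let GQ : Module.End R (ι → Q) := oddExt R par (LinearMap.id : Q →ₗ[R] Q)
    let oneπ : (ι → KT R n) →ₗ[R] (ι → Q) :=
      evExt R (((Submodule.mkQ (Ideal.span (Set.range u))) ∘ₗ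
        (LinearMap.proj (∅ : Finset (Fin n)) : KT R n →ₗ[R] R)))
    let σinf : (ι → Q) →ₗ[S] (ι → KT R n) :=
      ∑ m ∈ Finset.range (n + 1),
        ((oddExt S par h *
          ((matExt (dmat d) : Module.End R (ι → KT R n)).restrictScalars S)) ^ m) ∘ₗ
          evExt S σ
    let hinf : Module.End S (ι → KT R n) :=
      ∑ m ∈ Finset.range (n + 1),
        ((oddExt S par h *
          ((matExt (dmat d) : Module.End R (ι → KT R n)).restrictScalars S)) ^ m) *
          oddExt S par h
    -- (X ⊗ K(t), d⊗1 + 1⊗δ) and (X/tX, d) are linear factorisations of W: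
    (D * G = -(G * D)) ∧
    (D * D = algebraMap S R W • (1 : Module.End R (ι → KT R n))) ∧
    (DQ * GQ = -(GQ * DQ)) ∧
    (DQ * DQ = algebraMap S R W • (1 : Module.End R (ι → Q))) ∧
    -- the augmentation π : X ⊗ K(t) → X/tX is a morphism over R:
    (GQ ∘ₗ oneπ = oneπ ∘ₗ G) ∧
    (DQ ∘ₗ oneπ = oneπ ∘ₗ D) ∧
    -- σ∞ is a morphism of linear factorisations over S:
    (G.restrictScalars S ∘ₗ σinf = σinf ∘ₗ GQ.restrictScalars S) ∧
    (D.restrictScalars S ∘ₗ σinf = σinf ∘ₗ DQ.restrictScalars S) ∧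
    -- h∞ has degree one:
    (hinf * G.restrictScalars S = -(G.restrictScalars S * hinf)) ∧
    -- (X/tX, X⊗K(t), σ∞, π, h∞) is a deformation retract datum over S; in particular
    -- π is a homotopy equivalence of linear factorisations of W over S:
    (oneπ.restrictScalars S ∘ₗ σinf = LinearMap.id) ∧
    (σinf ∘ₗ oneπ.restrictScalars S =
      LinearMap.id +
        (D.restrictScalars S * hinf + hinf * D.restrictScalars S)) := by
  intro Q D G DQ GQ oneπ σinf hinf
  set dK : Module.End R (ι → KT R n) := matExt (dmat d)
  set dS : Module.End S (ι → KT R n) := dK.restrictScalars S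
  set hX : Module.End S (ι → KT R n) := oddExt S par h with hhX
  set σX : (ι → Q) →ₗ[S] (ι → KT R n) := evExt S σ with hσX
  set δX : Module.End R (ι → KT R n) := oddExt R par (delK u) with hδX
  set T : Module.End S (ι → KT R n) := ∑ m ∈ Finset.range (n + 1), (hX * dS) ^ m with hTdef
  set πS : (ι → KT R n) →ₗ[S] (ι → Q) := oneπ.restrictScalars S
  have hσinf : σinf = T ∘ₗ σX := by
    refine LinearMap.ext fun x => ?_
    simp only [σinf, hTdef, LinearMap.sum_apply, LinearMap.comp_apply]
    rfl
  have hhinf : hinf = T * hX := (Finset.sum_mul _ _ _).symm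
  -- the perturbation is nilpotent, so `T` inverts `1 - hd`
  have hnil : (hX * dS) ^ (n + 1) = 0 := pow_oddExt_matExt_eq_zero hh_deg par (dmat d)
  have hT : (1 - hX * dS) * T = 1 := by rw [hTdef, mul_neg_geom_sum, hnil, sub_zero]
  have hT' : T * (1 - hX * dS) = 1 := by rw [hTdef, geom_sum_mul_neg, hnil, sub_zero]
  -- pointwise relations between the extended maps
  have eqσπ : ∀ f : KT R n, σ (Submodule.mkQ (Ideal.span (Set.range u)) (f ∅))
      = f + (delK u (h f) + h (delK u f)) := fun f => LinearMap.congr_fun hσπ f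
  have eqπσ : ∀ q : Q, Submodule.mkQ (Ideal.span (Set.range u)) (σ q ∅) = q :=
    fun q => LinearMap.congr_fun hπσ q
  have eqπh : ∀ f : KT R n, Submodule.mkQ (Ideal.span (Set.range u)) (h f ∅) = 0 :=
    fun f => LinearMap.congr_fun hπh f
  have hodd : ∀ x, dK (δX x) = -δX (dK x) := fun x => matExt_oddExt hd_odd _ x
  have hδsq : ∀ x, δX (δX x) = 0 := fun x => funext fun a => by
    rw [hδX, oddExt_apply, oddExt_apply, map_zsmul, delK_delK, smul_zero, smul_zero,
      Pi.zero_apply]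
  have hdsq : ∀ x, dK (dK x) = algebraMap S R W • x := fun x => matExt_dmat_sq hd_sq x
  have hπd : ∀ x, DQ (oneπ x) = oneπ (dK x) := fun x => matExt_evExt _ _ x
  have hπδ : ∀ x, oneπ (δX x) = 0 := fun x => funext fun a => by
    change Submodule.mkQ (Ideal.span (Set.range u)) (psign par a • delK u (x a) ∅) = 0
    rw [map_zsmul, Submodule.mkQ_apply,
      (Submodule.Quotient.mk_eq_zero _).2 (delK_apply_empty_mem u (x a)), smul_zero]
  have hδσ : ∀ y, δX (σX y) = 0 := fun y => funext fun a => by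
    rw [hδX, oddExt_apply, hσX, evExt_apply, delK_eq_zero u (hσ_deg (y a)), smul_zero,
      Pi.zero_apply]
  have hhσX : ∀ y, hX (σX y) = 0 := fun y => funext fun a => by
    rw [hhX, oddExt_apply, hσX, evExt_apply, show h (σ (y a)) = 0 from LinearMap.congr_fun hhσ _,
      smul_zero, Pi.zero_apply]
  have hπhX : ∀ x, oneπ (hX x) = 0 := fun x => funext fun a => by
    change Submodule.mkQ (Ideal.span (Set.range u)) (psign par a • h (x a) ∅) = 0
    rw [map_zsmul, eqπh, smul_zero]
  have hπσX : ∀ y, oneπ (σX y) = y := fun y => funext fun a => eqπσ (y a)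
  have hhh : hX * hX = 0 := LinearMap.ext fun x => funext fun a => by
    rw [Module.End.mul_apply, hhX, oddExt_apply, oddExt_apply, map_zsmul,
      show h (h (x a)) = 0 from LinearMap.congr_fun hh2 _, smul_zero, smul_zero]
    rfl
  have hp : σX ∘ₗ πS = 1 + (δX.restrictScalars S * hX + hX * δX.restrictScalars S) :=
    LinearMap.ext fun x => funext fun a => by
      refine (eqσπ (x a)).trans ?_
      change _ = x a + (δX (hX x) a + hX (δX x) a)
      rw [hδX, hhX, oddExt_apply, oddExt_apply, oddExt_apply, oddExt_apply, map_zsmul, map_zsmul,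
        psign_smul_psign_smul, psign_smul_psign_smul]
  have hanti : dS * δX.restrictScalars S + δX.restrictScalars S * dS = 0 :=
    LinearMap.ext fun x => by
      change dK (δX x) + δX (dK x) = 0
      rw [hodd, neg_add_cancel]
  have hw : hX * (dS * dS) = (W • (1 : Module.End S (ι → KT R n))) * hX :=
    LinearMap.ext fun x => by
      change hX (dK (dK x)) = W • hX x
      rw [hdsq, algebraMap_smul, map_smul]
  have hph : (σX ∘ₗ πS) * hX = 0 := LinearMap.ext fun x => by
    change σX (oneπ (hX x)) = 0
    rw [hπhX, map_zero]
  have hpd : (σX ∘ₗ πS) * dS * (σX ∘ₗ πS) = (σX ∘ₗ πS) * dS := LinearMap.ext fun x => by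
    change σX (oneπ (dK (σX (oneπ x)))) = σX (oneπ (dK x))
    rw [← hπd, hπσX, hπd]
  have hπT : ∀ x, oneπ (T x) = oneπ x := fun x => by
    have h1 : T x = x + hX (dS (T x)) := by
      have h2 := LinearMap.congr_fun hT x
      simp only [sub_mul, one_mul, LinearMap.sub_apply, Module.End.mul_apply,
        Module.End.one_apply] at h2
      exact eq_add_of_sub_eq h2
    rw [h1, map_add, hπhX, add_zero]
  -- gradings
  have hdG : ∀ x, dK (G x) = -G (dK x) := fun x => matExt_oddExt hd_odd _ x
  have hδG : ∀ x, δX (G x) = -G (δX x) := fun x => funext fun a => by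
    simp only [G, hδX, Pi.neg_apply, oddExt_apply, map_zsmul, delK_gK, smul_neg]
  have hhG : ∀ x, hX (G x) = -G (hX x) := fun x => funext fun a => by
    simp only [G, hhX, Pi.neg_apply, oddExt_apply, map_zsmul, degree_one_map_gK hh_deg, smul_neg]
  have hGσ : ∀ y, G (σX y) = σX (GQ y) := fun y => funext fun a => by
    simp only [G, GQ, hσX, evExt_apply, oddExt_apply, map_zsmul, LinearMap.id_apply]
    congr 1
    funext I
    rw [gK_apply]
    by_cases hI : I = ∅
    · simp [hI]
    · rw [hσ_deg _ _ hI, mul_zero]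
  have hcomm : Commute (G.restrictScalars S) T := by
    refine Commute.sum_right _ _ _ fun m _ => Commute.pow_right ?_ m
    refine LinearMap.ext fun x => ?_
    change G (hX (dK x)) = hX (dK (G x))
    rw [hdG, map_neg, hhG, neg_neg]
  have hTG : ∀ x, G (T x) = T (G x) := fun x => LinearMap.congr_fun hcomm.eq x
  refine ⟨?_, ?_, ?_, ?_, ?_, ?_, ?_, ?_, ?_, ?_, ?_⟩
  · refine LinearMap.ext fun x => ?_
    change dK (G x) + δX (G x) = -G (dK x + δX x)
    rw [hdG, hδG, map_add, neg_add]
  · refine LinearMap.ext fun x => ?_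
    change dK (dK x + δX x) + δX (dK x + δX x) = algebraMap S R W • x
    rw [map_add, map_add, hodd, hδsq, hdsq]
    abel
  · exact LinearMap.ext fun y => matExt_oddExt hd_odd _ y
  · exact LinearMap.ext fun y => matExt_dmat_sq hd_sq y
  · refine LinearMap.ext fun x => funext fun a => ?_
    change psign par a • Submodule.mkQ (Ideal.span (Set.range u)) (x a ∅) =
      Submodule.mkQ (Ideal.span (Set.range u)) (psign par a • gK R n (x a) ∅)
    rw [map_zsmul, gK_apply, Finset.card_empty, pow_zero, one_mul]
  · refine LinearMap.ext fun x => ?_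
    change DQ (oneπ x) = oneπ (dK x + δX x)
    rw [map_add, hπδ, add_zero, hπd]
  · rw [hσinf]
    refine LinearMap.ext fun y => ?_
    change G (T (σX y)) = T (σX (GQ y))
    rw [hTG, hGσ]
  · rw [hσinf]
    refine LinearMap.ext fun y => ?_
    have h1 := LinearMap.congr_fun
      (perturbed_differential hp hanti hw hhh hph hpd hT hT') (σX y)
    simp only [LinearMap.add_apply, LinearMap.sub_apply, Module.End.mul_apply,
      LinearMap.smul_apply, Module.End.one_apply, LinearMap.comp_apply] at h1
    rw [hhσX, smul_zero, map_zero, sub_zero, LinearMap.restrictScalars_apply S δX (σX y), hδσ,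
      map_zero, zero_add] at h1
    have h2 : πS (dS (σX y)) = DQ y := (hπd _).symm.trans (congrArg DQ (hπσX y))
    rw [h2] at h1
    exact h1
  · rw [hhinf]
    refine LinearMap.ext fun x => ?_
    change T (hX (G x)) = -G (T (hX x))
    rw [hhG, map_neg, hTG]
  · rw [hσinf]
    refine LinearMap.ext fun y => ?_
    change oneπ (T (σX y)) = y
    rw [hπT, hπσX]
  · rw [hσinf, hhinf]
    have hDS : D.restrictScalars S = dS + δX.restrictScalars S := LinearMap.ext fun _ => rfl
    rw [hDS]
    exact perturbed_homotopy hp hanti hw hhh hph hpd hT hT'
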